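/- Let G be an acyclically edge (Δ(G)+1)-critical finite simple graph and let v be any vertex of G. Then the number of neighbors of v having degree 2 is at most Δ(G) − 2. -/

import Mathlib

open SimpleGraph

/-- A proper edge coloring of `G`: distinct edges sharing a vertex get distinct colors. -/
def IsProperEdgeColoring {V : Type*} {α : Type*} (G : SimpleGraph V) (c : Sym2 V → α) : Prop :=
  ∀ e₁ ∈ G.edgeSet, ∀ e₂ ∈ G.edgeSet, e₁ ≠ e₂ → (∃ v, v ∈ e₁ ∧ v ∈ e₂) → c e₁ ≠ c e₂

/-- An acyclic edge coloring: proper, and no cycle of `G` uses at most two colors. -/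
def IsAcyclicEdgeColoring {V : Type*} {α : Type*} (G : SimpleGraph V) (c : Sym2 V → α) : Prop :=
  IsProperEdgeColoring G c ∧
    ∀ (v : V) (w : G.Walk v v), w.IsCycle →
      ¬ ∃ a b : α, ∀ e ∈ w.edges, c e = a ∨ c e = b

/-- `G` has an acyclic edge coloring with `k` colors. -/
def AcyclicEdgeColorable {V : Type*} (G : SimpleGraph V) (k : ℕ) : Prop :=
  ∃ c : Sym2 V → Fin k, IsAcyclicEdgeColoring G c

/-- The acyclic chromatic index: least `k` such that `G` is acyclically edge `k`-colorable. -/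
noncomputable def acyclicChromaticIndex {V : Type*} (G : SimpleGraph V) : ℕ :=
  sInf {k | AcyclicEdgeColorable G k}

/-- `G` is acyclically edge `k`-critical: `G` is not acyclically edge `k`-colorable, but every
proper subgraph of `G` is. -/
def IsAcyclicallyEdgeCritical {V : Type*} (G : SimpleGraph V) (k : ℕ) : Prop :=
  ¬ AcyclicEdgeColorable G k ∧ ∀ H : SimpleGraph V, H < G → AcyclicEdgeColorable H k

theorem isProperEdgeColoring_iff {V α : Type*} {G : SimpleGraph V} {c : Sym2 V → α} :
    IsProperEdgeColoring G c ↔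
      ∀ a b b', G.Adj a b → G.Adj a b' → b ≠ b' → c s(a, b) ≠ c s(a, b') := by
  constructor
  · intro h a b b' hb hb' hne
    exact h _ hb _ hb' (fun h => hne (Sym2.congr_right.1 h)) ⟨a, by simp, by simp⟩
  · rintro h e₁ h₁ e₂ h₂ hne ⟨a, ha₁, ha₂⟩
    obtain ⟨b, rfl⟩ := ha₁
    obtain ⟨b', rfl⟩ := ha₂
    exact h a b b' h₁ h₂ (by rintro rfl; exact hne rfl)

theorem Finset.exists_notMem_of_card_lt_card_univ {α : Type*} [Fintype α] {s : Finset α}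
    (h : s.card < Fintype.card α) : ∃ a, a ∉ s := by
  by_contra! hs
  rw [Finset.eq_univ_iff_forall.2 hs, Finset.card_univ] at h
  exact h.false

/-- Every vertex of a cycle has, for each given vertex `a`, a neighbor along the cycle other
than `a`. -/
theorem SimpleGraph.Walk.IsCycle.exists_mem_edges_ne {V : Type*} {G : SimpleGraph V} {r : V}
    {w : G.Walk r r} (hw : w.IsCycle) {x : V} (hx : x ∈ w.support) (a : V) :
    ∃ y, y ≠ a ∧ s(x, y) ∈ w.edges := by
  obtain ⟨y, hy, hya⟩ := Set.exists_ne_of_one_lt_ncard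
    (hw.ncard_neighborSet_toSubgraph_eq_two hx ▸ Nat.one_lt_two) a
  exact ⟨y, hya, (w.mem_edges_toSubgraph).1 hy⟩

/-- A vertex of degree two has exactly one neighbor besides a given one. -/
theorem SimpleGraph.exists_adj_iff_of_degree_eq_two {V : Type*} [DecidableEq V]
    {G : SimpleGraph V} {u v : V} [Fintype (G.neighborSet u)] (hu : G.degree u = 2)
    (huv : G.Adj u v) : ∃ w, w ≠ v ∧ ∀ z, G.Adj u z ↔ z = v ∨ z = w := by
  obtain ⟨a, b, hab, h⟩ := Finset.card_eq_two.1 hu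
  have key : ∀ z, G.Adj u z ↔ z = a ∨ z = b := fun z => by
    rw [← G.mem_neighborFinset, h]; simp
  rcases (key v).1 huv with rfl | rfl
  · exact ⟨b, hab.symm, key⟩
  · exact ⟨a, hab, fun z => (key z).trans or_comm⟩

/-- Recoloring the two edges at a vertex `u` of degree two turns an acyclic coloring of `G - vu`
into one of `G`, provided that no path of the two new colors can leave `v`. -/
theorem IsAcyclicEdgeColoring.update_update {V α : Type*} [DecidableEq V] {G : SimpleGraph V}
    {u v u' : V} {c : Sym2 V → α} (hc : IsAcyclicEdgeColoring (G.deleteEdges {s(v, u)}) c)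
    (hu' : u' ≠ v) (hu : ∀ z, G.Adj u z ↔ z = v ∨ z = u') {i j : α} (hij : i ≠ j)
    (hj : ∀ y, G.Adj u' y → y ≠ u → c s(u', y) ≠ j)
    (hi : ∀ y, G.Adj v y → y ≠ u → c s(v, y) ≠ i)
    (hyz : ∀ y z, G.Adj v y → y ≠ u → c s(v, y) = j → G.Adj y z → z ≠ v → c s(y, z) ≠ i) :
    IsAcyclicEdgeColoring G (Function.update (Function.update c s(u, u') j) s(v, u) i) := by
  obtain ⟨hp, hac⟩ := hc
  rw [isProperEdgeColoring_iff] at hp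
  set c' := Function.update (Function.update c s(u, u') j) s(v, u) i with hc'
  have huv : G.Adj u v := (hu v).2 (Or.inl rfl)
  have hne : u ≠ v := huv.ne
  have hvu : c' s(v, u) = i := by simp [hc']
  have huv' : c' s(u, v) = i := by rw [Sym2.eq_swap, hvu]
  have hcu : c' s(u, u') = j := by
    rw [hc', Function.update_of_ne, Function.update_self]
    simp [hne, hu']
  have hcu' : c' s(u', u) = j := by rw [Sym2.eq_swap, hcu]
  have hcc : ∀ a b, a ≠ u → b ≠ u → c' s(a, b) = c s(a, b) := by
    intro a b ha hb
    rw [hc', Function.update_of_ne, Function.update_of_ne] <;>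
      simp only [ne_eq, Sym2.eq_iff] <;> tauto
  have hH : ∀ a b, a ≠ u → b ≠ u → G.Adj a b → (G.deleteEdges {s(v, u)}).Adj a b := by
    intro a b ha hb hab
    rw [SimpleGraph.deleteEdges_adj]
    refine ⟨hab, ?_⟩
    simp only [Set.mem_singleton_iff, Sym2.eq_iff]
    tauto
  have hend : ∀ a b', a ≠ u → G.Adj a u → G.Adj a b' → b' ≠ u → c' s(a, u) ≠ c' s(a, b') := by
    intro a b' hau h h' hb'
    rw [hcc a b' hau hb']
    rcases (hu a).1 h.symm with rfl | rfl
    · rw [hvu]; exact (hi b' h' hb').symm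
    · rw [hcu']; exact (hj b' h' hb').symm
  have hp' : ∀ a b b', G.Adj a b → G.Adj a b' → b ≠ b' → c' s(a, b) ≠ c' s(a, b') := by
    intro a b b' hb hb' hbb
    by_cases hau : a = u
    · subst hau
      rcases (hu b).1 hb with rfl | rfl <;> rcases (hu b').1 hb' with rfl | rfl
      · exact absurd rfl hbb
      · rwa [huv', hcu]
      · rw [huv', hcu]; exact hij.symm
      · exact absurd rfl hbb
    · by_cases hbu : b = u
      · subst hbu; exact hend a b' hau hb hb' hbb.symm
      · by_cases hbu' : b' = u
        · subst hbu'; exact (hend a b hau hb' hb hbb).symm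
        · rw [hcc a b hau hbu, hcc a b' hau hbu']
          exact hp a b b' (hH _ _ hau hbu hb) (hH _ _ hau hbu' hb') hbb
  refine ⟨isProperEdgeColoring_iff.2 hp', ?_⟩
  rintro r w hw ⟨a, b, hab⟩
  by_cases huw : u ∈ w.support
  · have hadj : ∀ {x y}, s(x, y) ∈ w.edges → G.Adj x y := fun h => w.adj_of_mem_edges h
    have huv_mem : s(u, v) ∈ w.edges := by
      obtain ⟨y, hy, hmem⟩ := hw.exists_mem_edges_ne huw u'
      rcases (hu y).1 (hadj hmem) with rfl | rfl
      · exact hmem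
      · exact absurd rfl hy
    have huu_mem : s(u, u') ∈ w.edges := by
      obtain ⟨y, hy, hmem⟩ := hw.exists_mem_edges_ne huw v
      rcases (hu y).1 (hadj hmem) with rfl | rfl
      · exact absurd rfl hy
      · exact hmem
    have hcol : ∀ e ∈ w.edges, c' e = i ∨ c' e = j := by
      have h₁ := hab _ huv_mem
      have h₂ := hab _ huu_mem
      rw [huv'] at h₁
      rw [hcu] at h₂
      intro e he
      have := hab e he
      grind
    obtain ⟨y, hyu, hvy⟩ := hw.exists_mem_edges_ne (w.snd_mem_support_of_mem_edges huv_mem) u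
    have hcvy : c s(v, y) = j := by
      have := hcol _ hvy
      rw [hcc v y hne.symm hyu] at this
      exact this.resolve_left (hi y (hadj hvy) hyu)
    obtain ⟨z, hzv, hyz_mem⟩ := hw.exists_mem_edges_ne (w.snd_mem_support_of_mem_edges hvy) v
    have hcyz : c' s(y, z) = i := by
      refine (hcol _ hyz_mem).resolve_right fun h => ?_
      refine hp' y z v (hadj hyz_mem) (hadj hvy).symm hzv ?_
      rw [h, Sym2.eq_swap, hcc v y hne.symm hyu, hcvy]
    by_cases hzu : z = u
    · subst hzu
      rcases (hu y).1 (hadj hyz_mem).symm with rfl | rfl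
      · exact (hadj hvy).ne rfl
      · exact hij (hcyz.symm.trans hcu')
    · rw [hcc y z hyu hzu] at hcyz
      exact hyz y z (hadj hvy) hyu hcvy (hadj hyz_mem) hzv hcyz
  · have hmem : ∀ x y, s(x, y) ∈ w.edges → x ≠ u ∧ y ≠ u := fun x y h =>
      ⟨fun hx => huw (hx ▸ w.fst_mem_support_of_mem_edges h),
        fun hy => huw (hy ▸ w.snd_mem_support_of_mem_edges h)⟩
    have hwH : ∀ e ∈ w.edges, e ∈ (G.deleteEdges {s(v, u)}).edgeSet := by
      intro e he
      induction e with
      | _ x y => exact hH x y (hmem x y he).1 (hmem x y he).2 (w.adj_of_mem_edges he)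
    refine hac r (w.transfer _ hwH) (hw.transfer hwH) ⟨a, b, fun e he => ?_⟩
    rw [SimpleGraph.Walk.edges_transfer] at he
    induction e with
    | _ x y =>
      rw [← hcc x y (hmem x y he).1 (hmem x y he).2]
      exact hab _ he

theorem stmt7 {V : Type*} [Fintype V] [DecidableEq V] (G : SimpleGraph V) [DecidableRel G.Adj]
    (hG : IsAcyclicallyEdgeCritical G (G.maxDegree + 1)) (v : V) :
    ((G.neighborFinset v).filter fun w => G.degree w = 2).card ≤ G.maxDegree - 2 := by
  by_contra! hlt
  obtain ⟨u, hu⟩ := Finset.card_pos.1 (Nat.zero_lt_of_lt hlt)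
  rw [Finset.mem_filter, SimpleGraph.mem_neighborFinset] at hu
  obtain ⟨hvu, hu2⟩ := hu
  obtain ⟨u', hu', hadj⟩ := G.exists_adj_iff_of_degree_eq_two hu2 hvu.symm
  have hΔ : 2 ≤ G.maxDegree := hu2 ▸ G.degree_le_maxDegree u
  have hdeg : ((G.neighborFinset v).filter fun w => ¬ G.degree w = 2).card ≤ 1 := by
    have h₁ := Finset.card_filter_add_card_filter_not (s := G.neighborFinset v)
      (fun w => G.degree w = 2)
    have h₂ := G.degree_le_maxDegree v
    rw [G.card_neighborFinset_eq_degree] at h₁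
    omega
  have hHG : G.deleteEdges {s(v, u)} < G := by
    refine lt_of_le_of_ne (G.deleteEdges_le _) fun h => ?_
    have : (G.deleteEdges {s(v, u)}).Adj v u := by rwa [h]
    simp at this
  obtain ⟨c, hc⟩ := hG.2 _ hHG
  have hcard : ∀ {x y}, G.Adj x y →
      (((G.neighborFinset x).erase y).image fun z => c s(x, z)).card + 1 ≤ G.maxDegree := by
    intro x y hxy
    have h₁ := Finset.card_image_le (s := (G.neighborFinset x).erase y) (f := fun z => c s(x, z))
    have h₂ := Finset.card_erase_add_one ((G.mem_neighborFinset x y).2 hxy)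
    have h₃ := G.degree_le_maxDegree x
    rw [G.card_neighborFinset_eq_degree] at h₂
    omega
  obtain ⟨j, hj⟩ : ∃ j, j ∉ (((G.neighborFinset u').erase u).image fun z => c s(u', z)) ∪
      (((G.neighborFinset v).filter fun w => ¬ G.degree w = 2).image fun z => c s(v, z)) := by
    apply Finset.exists_notMem_of_card_lt_card_univ
    have h₁ := hcard ((hadj u').2 (Or.inr rfl)).symm
    have h₂ := Finset.card_image_le (s := (G.neighborFinset v).filter fun w => ¬ G.degree w = 2)
      (f := fun z => c s(v, z))
    refine (Finset.card_union_le _ _).trans_lt ?_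
    rw [Fintype.card_fin]
    omega
  simp only [Finset.mem_union, Finset.mem_image, Finset.mem_erase, Finset.mem_filter,
    SimpleGraph.mem_neighborFinset, not_or, not_exists, not_and, and_imp] at hj
  obtain ⟨hju, hjv⟩ := hj
  have hfree : ∀ k, ∃ i, i ≠ k ∧ ∀ y, G.Adj v y → y ≠ u → c s(v, y) ≠ i := by
    intro k
    obtain ⟨i, hi⟩ := Finset.exists_notMem_of_card_lt_card_univ
      (s := insert k (((G.neighborFinset v).erase u).image fun z => c s(v, z))) (by
        refine (Finset.card_insert_le _ _).trans_lt ?_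
        rw [Fintype.card_fin]
        exact Nat.lt_succ_of_le (hcard hvu))
    simp only [Finset.mem_insert, Finset.mem_image, Finset.mem_erase,
      SimpleGraph.mem_neighborFinset, not_or, not_exists, not_and, and_imp] at hi
    exact ⟨i, hi.1, fun y hy hyu => hi.2 y hyu hy⟩
  obtain ⟨i, hij, hi, hyz⟩ : ∃ i, i ≠ j ∧ (∀ y, G.Adj v y → y ≠ u → c s(v, y) ≠ i) ∧
      ∀ y z, G.Adj v y → y ≠ u → c s(v, y) = j → G.Adj y z → z ≠ v → c s(y, z) ≠ i := by
    by_cases h : ∃ y, G.Adj v y ∧ y ≠ u ∧ c s(v, y) = j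
    · obtain ⟨y, hy, hyu, hyj⟩ := h
      have hy2 : G.degree y = 2 := by
        by_contra hy2
        exact hjv y hy hy2 hyj
      obtain ⟨z, -, hz⟩ := G.exists_adj_iff_of_degree_eq_two hy2 hy.symm
      obtain ⟨i, hik, hi⟩ := hfree (c s(y, z))
      refine ⟨i, fun h => hi y hy hyu (hyj.trans h.symm), hi, ?_⟩
      intro y' z' hy' hyu' hyj' hz' hzv'
      obtain rfl : y' = y := by
        by_contra hne
        refine isProperEdgeColoring_iff.1 hc.1 v y' y ?_ ?_ hne (hyj'.trans hyj.symm) <;>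
          simp [SimpleGraph.deleteEdges_adj, hvu.ne, *]
      obtain rfl := ((hz z').1 hz').resolve_left hzv'
      exact hik.symm
    · obtain ⟨i, hij, hi⟩ := hfree j
      exact ⟨i, hij, hi, fun y z hy hyu hyj => absurd ⟨y, hy, hyu, hyj⟩ h⟩
  exact hG.1 ⟨_, hc.update_update hu' hadj hij (fun y hy hyu => hju y hyu hy) hi hyz⟩
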